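/- For every N ≥ 2 and every 0 < α ≤ 1, c_η^N(α) = h*_η(α) / (4α), where h*_η is the concave envelope on [0,1] of the function h_η defined by h_η(q) = ν_η(z_q), with z_q the unique element of [(η−1)Δ, (η+1)Δ] satisfying k_η(z_q) = q. -/

import Mathlib

open MeasureTheory ProbabilityTheory

noncomputable section

def midN (N : ℕ) (p : ℝ × (Fin (N-1) → ℝ)) : ℝ :=
  (max p.1 (⨆ i, p.2 i) + min p.1 (⨅ i, p.2 i)) / 2

def accN (N : ℕ) (η Δ : ℝ) : Set (ℝ × (Fin (N-1) → ℝ)) :=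
  {p | max p.1 (⨆ i, p.2 i) - min p.1 (⨅ i, p.2 i) ≤ η * Δ}

def PA_N (N : ℕ) (η Δ : ℝ) (μ : Measure ℝ) (ν : Measure (Fin (N-1) → ℝ)) : ℝ :=
  ((μ.prod ν) (accN N η Δ)).toReal

def MSE_N (N : ℕ) (η Δ : ℝ) (μ : Measure ℝ) (ν : Measure (Fin (N-1) → ℝ)) : ℝ :=
  ∫ p, (midN N p) ^ 2 ∂((μ.prod ν)[|accN N η Δ])

def mid2 (p : ℝ × ℝ) : ℝ := (max p.1 p.2 + min p.1 p.2) / 2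

def acc2 (η Δ : ℝ) : Set (ℝ × ℝ) := {p | max p.1 p.2 - min p.1 p.2 ≤ η * Δ}

def PA_2 (η Δ : ℝ) (μ κ : Measure ℝ) : ℝ := ((μ.prod κ) (acc2 η Δ)).toReal

def MSE_2 (η Δ : ℝ) (μ κ : Measure ℝ) : ℝ :=
  ∫ p, (mid2 p) ^ 2 ∂((μ.prod κ)[|acc2 η Δ])

def cN (N : ℕ) (η Δ : ℝ) (μ : Measure ℝ) (α : ℝ) : ℝ :=
  sSup {r | ∃ ν : Measure (Fin (N-1) → ℝ), IsProbabilityMeasure ν ∧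
    α ≤ PA_N N η Δ μ ν ∧ r = MSE_N N η Δ μ ν}

def c2 (η Δ : ℝ) (μ : Measure ℝ) (α : ℝ) : ℝ :=
  sSup {r | ∃ κ : Measure ℝ, IsProbabilityMeasure κ ∧
    α ≤ PA_2 η Δ μ κ ∧ r = MSE_2 η Δ μ κ}

def IsBestResponseN (N : ℕ) (η Δ : ℝ) (μ : Measure ℝ) (QAD : ℝ → ℝ → ℝ)
    (ν : Measure (Fin (N-1) → ℝ)) : Prop :=
  IsProbabilityMeasure ν ∧ 0 < PA_N N η Δ μ ν ∧
    ∀ ν' : Measure (Fin (N-1) → ℝ), IsProbabilityMeasure ν' → 0 < PA_N N η Δ μ ν' →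
      QAD (MSE_N N η Δ μ ν') (PA_N N η Δ μ ν') ≤ QAD (MSE_N N η Δ μ ν) (PA_N N η Δ μ ν)

def IsBestResponse2 (η Δ : ℝ) (μ : Measure ℝ) (QAD : ℝ → ℝ → ℝ) (κ : Measure ℝ) : Prop :=
  IsProbabilityMeasure κ ∧ 0 < PA_2 η Δ μ κ ∧
    ∀ κ' : Measure ℝ, IsProbabilityMeasure κ' → 0 < PA_2 η Δ μ κ' →
      QAD (MSE_2 η Δ μ κ') (PA_2 η Δ μ κ') ≤ QAD (MSE_2 η Δ μ κ) (PA_2 η Δ μ κ)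


def secN (R M m : ℝ) : Set ℝ := {n | max n M - min n m ≤ R}

lemma measSet_sec (R M m : ℝ) : MeasurableSet (secN R M m) := by
  unfold secN
  exact measurableSet_le (by fun_prop) measurable_const

lemma integrable_of_cont {μ : Measure ℝ} [IsProbabilityMeasure μ] {Δ : ℝ}
    (hs : ∀ᵐ n ∂μ, n ∈ Set.Icc (-Δ) Δ) {g : ℝ → ℝ} (hg : Continuous g) : Integrable g μ := by
  have : μ.restrict (Set.Icc (-Δ) Δ) = μ := Measure.restrict_eq_self_of_ae_mem hs
  rw [← this]
  exact hg.continuousOn.integrableOn_compact isCompact_Icc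

lemma key_neg {μ : Measure ℝ} (hneg : μ.map (fun x => -x) = μ) (R M m : ℝ) (g : ℝ → ℝ) :
    ∫ n in secN R M m, g (max n M + min n m) ∂μ =
      ∫ n in secN R (-m) (-M), g (-(max n (-m) + min n (-M))) ∂μ := by
  rw [← integral_indicator (measSet_sec _ _ _), ← integral_indicator (measSet_sec _ _ _)]
  have e : MeasurableEmbedding (fun x : ℝ => -x) := (MeasurableEquiv.neg ℝ).measurableEmbedding
  conv_lhs => rw [← hneg]
  rw [e.integral_map]
  congr 1
  ext n
  have h1 : max (-n) M = - min n (-M) := by rw [← max_neg_neg]; simp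
  have h2 : min (-n) m = - max n (-m) := by rw [← min_neg_neg]; simp
  have : (-n ∈ secN R M m) ↔ n ∈ secN R (-m) (-M) := by
    simp only [secN, Set.mem_ofPred_eq, h1, h2]
    constructor <;> intro h <;> linarith
  by_cases hn : n ∈ secN R (-m) (-M)
  · rw [Set.indicator_of_mem hn, Set.indicator_of_mem (this.2 hn), h1, h2]
    congr 1; ring
  · rw [Set.indicator_of_notMem hn, Set.indicator_of_notMem (fun h => hn (this.1 h))]

section
variable {μ : Measure ℝ} [IsProbabilityMeasure μ] {η Δ : ℝ}

lemma key1 (hΔ : 0 < Δ) (hη : 2 ≤ η) (hs : ∀ᵐ n ∂μ, n ∈ Set.Icc (-Δ) Δ)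
    {M m : ℝ} (hM : (η - 1) * Δ ≤ M) (hMm : M - m ≤ η * Δ) :
    (∫ _n in secN (η * Δ) M m, (1:ℝ) ∂μ) = (∫ _n in Set.Ici (M - η * Δ), (1:ℝ) ∂μ) ∧
    (∫ n in secN (η * Δ) M m, (max n M + min n m)^2 ∂μ) ≤
      ∫ n in Set.Ici (M - η * Δ), (n + M)^2 ∂μ := by
  have hD : Δ ≤ M := by nlinarith
  have hset : (secN (η * Δ) M m) =ᵐ[μ] (Set.Ici (M - η * Δ)) := by
    filter_upwards [hs] with n hn
    have h1 : max n M = M := max_eq_right (hn.2.trans hD)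
    apply propext
    change max n M - min n m ≤ η * Δ ↔ M - η * Δ ≤ n
    rw [h1]
    constructor
    · intro h; linarith [min_le_left n m]
    · intro h
      rcases min_cases n m with h | h <;> linarith [h.1]
  refine ⟨setIntegral_congr_set hset, ?_⟩
  rw [setIntegral_congr_set hset]
  apply setIntegral_mono_on_ae
  · exact (integrable_of_cont hs (by fun_prop)).integrableOn
  · exact (integrable_of_cont hs (by fun_prop)).integrableOn
  · exact measurableSet_Ici
  filter_upwards [hs] with n hn hn2
  have h1 : max n M = M := max_eq_right (hn.2.trans hD)
  rw [h1]
  have h3 := hn.1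
  have h4 : M - η * Δ ≤ n := hn2
  have h5 : 0 ≤ M + min n m := by
    rcases min_cases n m with h | h
    · linarith
    · nlinarith
  have h6 : M + min n m ≤ n + M := by linarith [min_le_left n m]
  exact pow_le_pow_left₀ h5 h6 2

lemma phi_bound {n M m Z : ℝ} (h0 : m ≤ M) (h1 : M ≤ Z) (h2 : -Z ≤ m) :
    (max n M + min n m)^2 + (max (-n) M + min (-n) m)^2 ≤ (n + Z)^2 + (-n + Z)^2 := by
  have bd : ∀ a : ℝ, -Z ≤ max a M + min a m - a ∧ max a M + min a m - a ≤ Z := by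
    intro a
    rcases max_cases a M with h | h <;> rcases min_cases a m with h' | h' <;>
      constructor <;> linarith [h.1, h'.1]
  have anti : ∀ a b : ℝ, a ≤ b → max b M + min b m - b ≤ max a M + min a m - a := by
    intro a b hab
    rcases max_cases a M with h | h <;> rcases min_cases a m with h' | h' <;>
    rcases max_cases b M with k | k <;> rcases min_cases b m with k' | k' <;>
      linarith [h.1, h'.1, k.1, k'.1]
  obtain ⟨a1, a2⟩ := bd n
  obtain ⟨b1, b2⟩ := bd (-n)
  have hm : n * ((max n M + min n m - n) - (max (-n) M + min (-n) m - -n)) ≤ 0 := by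
    rcases le_total 0 n with hn | hn
    · exact mul_nonpos_of_nonneg_of_nonpos hn (by linarith [anti (-n) n (by linarith)])
    · exact mul_nonpos_of_nonpos_of_nonneg hn (by linarith [anti n (-n) (by linarith)])
  generalize max n M + min n m = s at *
  generalize max (-n) M + min (-n) m = t at *
  have q1 : (s - n)^2 ≤ Z^2 := sq_le_sq' a1 a2
  have q2 : (t - -n)^2 ≤ Z^2 := sq_le_sq' b1 b2
  nlinarith

lemma key3 (hs : ∀ᵐ n ∂μ, n ∈ Set.Icc (-Δ) Δ)
    (hneg : μ.map (fun x => -x) = μ)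
    {M m : ℝ} (h0 : m ≤ M) (hM : M ≤ (η - 1) * Δ) (hm : -((η - 1) * Δ) ≤ m)
    (hMm : M - m ≤ η * Δ) (hR : 2 * Δ ≤ η * Δ) :
    (∫ _n in secN (η * Δ) M m, (1:ℝ) ∂μ) = 1 ∧
    (∫ n in secN (η * Δ) M m, (max n M + min n m)^2 ∂μ) ≤
      ∫ n in Set.Ici ((η - 1) * Δ - η * Δ), (n + (η - 1) * Δ)^2 ∂μ := by
  have hset : (secN (η * Δ) M m) =ᵐ[μ] Set.univ := by
    filter_upwards [hs] with n hn
    apply propext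
    change max n M - min n m ≤ η * Δ ↔ True
    simp only [iff_true]
    obtain ⟨h1, h2⟩ := hn
    rcases max_cases n M with h | h <;> rcases min_cases n m with h' | h' <;>
      linarith [h.1, h'.1]
  have hset2 : (Set.Ici ((η - 1) * Δ - η * Δ)) =ᵐ[μ] Set.univ := by
    filter_upwards [hs] with n hn
    apply propext
    change (η - 1) * Δ - η * Δ ≤ n ↔ True
    simp only [iff_true]
    linarith [hn.1]
  rw [setIntegral_congr_set hset, setIntegral_congr_set hset, setIntegral_congr_set hset2]
  simp only [setIntegral_univ]
  refine ⟨by simp, ?_⟩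
  have e : MeasurableEmbedding (fun x : ℝ => -x) := (MeasurableEquiv.neg ℝ).measurableEmbedding
  have flip : ∀ g : ℝ → ℝ, ∫ n, g n ∂μ = ∫ n, g (-n) ∂μ := by
    intro g
    conv_lhs => rw [← hneg]
    rw [e.integral_map]
  have f1 := flip (fun n => (max n M + min n m)^2)
  have f2 := flip (fun n => (n + (η - 1) * Δ)^2)
  have f3 : ∫ n, ((max n M + min n m)^2 + (max (-n) M + min (-n) m)^2) ∂μ ≤
      ∫ n, ((n + (η - 1) * Δ)^2 + (-n + (η - 1) * Δ)^2) ∂μ := by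
    apply integral_mono
    · exact integrable_of_cont hs (by fun_prop)
    · exact integrable_of_cont hs (by fun_prop)
    · intro n
      exact phi_bound h0 hM hm
  rw [integral_add (integrable_of_cont hs (by fun_prop)) (integrable_of_cont hs (by fun_prop)),
    integral_add (integrable_of_cont hs (by fun_prop)) (integrable_of_cont hs (by fun_prop))] at f3
  linarith

lemma key (hΔ : 0 < Δ) (hη : 2 ≤ η) (hs : ∀ᵐ n ∂μ, n ∈ Set.Icc (-Δ) Δ)
    (hneg : μ.map (fun x => -x) = μ) (hna : ∀ x, μ {x} = 0) {h : ℝ → ℝ}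
    (hh : ∀ z ∈ Set.Icc ((η - 1) * Δ) ((η + 1) * Δ),
      h (∫ _n in Set.Ici (z - η * Δ), (1:ℝ) ∂μ) = ∫ n in Set.Ici (z - η * Δ), (n + z)^2 ∂μ)
    {M m : ℝ} (h0 : m ≤ M) :
    (∫ n in secN (η * Δ) M m, (max n M + min n m)^2 ∂μ) ≤
      h (∫ _n in secN (η * Δ) M m, (1:ℝ) ∂μ) := by
  have big : ∀ z, (η + 1) * Δ ≤ z → μ (Set.Ici (z - η * Δ)) = 0 := by
    intro z hz
    have hsub : ∀ᵐ n ∂μ, n ∉ Set.Ici (z - η * Δ) := by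
      have h1 : ∀ᵐ n ∂μ, n ≠ Δ := by
        rw [ae_iff]; simpa using hna Δ
      filter_upwards [hs, h1] with n hn hn1 hn2
      exact hn1 (le_antisymm hn.2 (by have : z - η * Δ ≤ n := hn2; linarith))
    exact measure_eq_zero_iff_ae_notMem.2 hsub
  have hzero : h 0 = 0 := by
    have h1 := hh ((η + 1) * Δ) ⟨by nlinarith, le_rfl⟩
    rw [setIntegral_measure_zero _ (big _ le_rfl), setIntegral_measure_zero _ (big _ le_rfl)] at h1
    exact h1
  by_cases hMm : M - m ≤ η * Δ
  swap
  · have : secN (η * Δ) M m = ∅ := by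
      ext n
      simp only [secN, Set.mem_ofPred_eq, Set.mem_empty_iff_false, iff_false, not_le]
      linarith [le_max_right n M, min_le_right n m, not_le.1 hMm]
    simp [this, hzero]
  have case1 : ∀ M m : ℝ, M - m ≤ η * Δ → (η - 1) * Δ ≤ M →
    (∫ n in secN (η * Δ) M m, (max n M + min n m)^2 ∂μ) ≤
      h (∫ _n in secN (η * Δ) M m, (1:ℝ) ∂μ) := by
    intro M m hMm hM
    obtain ⟨e1, e2⟩ := key1 hΔ hη hs hM hMm
    rw [e1]
    rcases le_total M ((η + 1) * Δ) with h2 | h2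
    · rw [hh M ⟨hM, h2⟩]; exact e2
    · rw [setIntegral_measure_zero _ (big _ h2)] at e2 ⊢
      rw [hzero]; exact e2
  by_cases hM : (η - 1) * Δ ≤ M
  · exact case1 M m hMm hM
  by_cases hm : m ≤ -((η - 1) * Δ)
  · rw [key_neg hneg _ _ _ (fun y => y^2), key_neg hneg _ _ _ (fun _ => 1)]
    simp only [neg_sq]
    exact case1 _ _ (by linarith) (by linarith)
  · obtain ⟨e1, e2⟩ := key3 (η := η) hs hneg h0 (not_le.1 hM).le (not_le.1 hm).le hMm (by nlinarith)
    have h1 := hh ((η - 1) * Δ) ⟨le_rfl, by nlinarith⟩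
    have : (∫ _n in Set.Ici ((η - 1) * Δ - η * Δ), (1:ℝ) ∂μ) = 1 := by
      have hset2 : (Set.Ici ((η - 1) * Δ - η * Δ)) =ᵐ[μ] Set.univ := by
        filter_upwards [hs] with n hn
        apply propext
        change (η - 1) * Δ - η * Δ ≤ n ↔ True
        simp only [iff_true]
        linarith [hn.1]
      rw [setIntegral_congr_set hset2]; simp
    rw [this] at h1
    rw [e1, h1]; exact e2
end

def pF (N : ℕ) (η Δ : ℝ) (μ : Measure ℝ) (x : Fin (N-1) → ℝ) : ℝ :=
  ∫ _n in secN (η * Δ) (⨆ i, x i) (⨅ i, x i), (1:ℝ) ∂μ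

def cF (N : ℕ) (η Δ : ℝ) (μ : Measure ℝ) (x : Fin (N-1) → ℝ) : ℝ :=
  ∫ n in secN (η * Δ) (⨆ i, x i) (⨅ i, x i), (max n (⨆ i, x i) + min n (⨅ i, x i))^2 ∂μ

lemma meas_sup (N : ℕ) : Measurable (fun p : ℝ × (Fin (N-1) → ℝ) => max p.1 (⨆ i, p.2 i)) :=
  measurable_fst.max (Measurable.iSup fun i => (measurable_pi_apply i).comp measurable_snd)

lemma meas_inf (N : ℕ) : Measurable (fun p : ℝ × (Fin (N-1) → ℝ) => min p.1 (⨅ i, p.2 i)) :=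
  measurable_fst.min (Measurable.iInf fun i => (measurable_pi_apply i).comp measurable_snd)

lemma meas_acc (N : ℕ) (η Δ : ℝ) : MeasurableSet (accN N η Δ) :=
  measurableSet_le ((meas_sup N).sub (meas_inf N)) measurable_const

lemma swapF {N : ℕ} {η Δ : ℝ} {μ : Measure ℝ} [IsProbabilityMeasure μ]
    (hs : ∀ᵐ n ∂μ, n ∈ Set.Icc (-Δ) Δ) {F : ℝ × (Fin (N-1) → ℝ) → ℝ} (hF : Measurable F) {B : ℝ}
    (hB0 : 0 ≤ B)
    (hB : ∀ p : ℝ × (Fin (N-1) → ℝ), p.1 ∈ Set.Icc (-Δ) Δ → p ∈ accN N η Δ → |F p| ≤ B) :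
    (Measurable fun x : Fin (N-1) → ℝ =>
      ∫ n in secN (η * Δ) (⨆ i, x i) (⨅ i, x i), F (n, x) ∂μ) ∧
    (∀ x : Fin (N-1) → ℝ, |∫ n in secN (η * Δ) (⨆ i, x i) (⨅ i, x i), F (n, x) ∂μ| ≤ B) ∧
    (∀ ν : Measure (Fin (N-1) → ℝ), IsProbabilityMeasure ν →
      ∫ p in accN N η Δ, F p ∂(μ.prod ν) =
        ∫ x, ∫ n in secN (η * Δ) (⨆ i, x i) (⨅ i, x i), F (n, x) ∂μ ∂ν) := by
  have e : ∀ x : Fin (N-1) → ℝ, ∫ n in secN (η * Δ) (⨆ i, x i) (⨅ i, x i), F (n, x) ∂μ =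
      ∫ n, (accN N η Δ).indicator F (n, x) ∂μ := by
    intro x
    rw [← integral_indicator (measSet_sec _ _ _)]
    rfl
  simp only [e]
  have hm : Measurable ((accN N η Δ).indicator F) := hF.indicator (meas_acc N η Δ)
  have hbd : ∀ p : ℝ × (Fin (N-1) → ℝ), p.1 ∈ Set.Icc (-Δ) Δ →
      ‖(accN N η Δ).indicator F p‖ ≤ B := by
    intro p hp
    by_cases h : p ∈ accN N η Δ
    · rw [Set.indicator_of_mem h]; exact hB p hp h
    · rw [Set.indicator_of_notMem h]; simpa using hB0
  refine ⟨hm.stronglyMeasurable.integral_prod_left'.measurable, ?_, ?_⟩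
  · intro x
    have := norm_integral_le_of_norm_le_const (μ := μ) (C := B)
      (f := fun n => (accN N η Δ).indicator F (n, x)) (by
        filter_upwards [hs] with n hn
        exact hbd (n, x) hn)
    simpa using this
  · intro ν hν
    rw [← integral_indicator (meas_acc N η Δ)]
    apply integral_prod_symm
    refine Integrable.of_bound hm.aestronglyMeasurable B ?_
    have : ∀ᵐ p ∂(μ.prod ν), p.1 ∈ Set.Icc (-Δ) Δ :=
      Measure.quasiMeasurePreserving_fst.ae hs
    filter_upwards [this] with p hp
    exact hbd p hp

section
variable {N : ℕ} {η Δ : ℝ} {μ : Measure ℝ} [IsProbabilityMeasure μ]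

lemma pF_facts (hs : ∀ᵐ n ∂μ, n ∈ Set.Icc (-Δ) Δ) :
    Measurable (pF N η Δ μ) ∧ (∀ x, pF N η Δ μ x ∈ Set.Icc (0:ℝ) 1) ∧
    ∀ ν : Measure (Fin (N-1) → ℝ), IsProbabilityMeasure ν →
      PA_N N η Δ μ ν = ∫ x, pF N η Δ μ x ∂ν := by
  obtain ⟨h1, h2, h3⟩ := swapF (N := N) (η := η) hs (F := fun _ => 1) measurable_const
    (zero_le_one) (by simp)
  refine ⟨h1, fun x => ⟨?_, (le_abs_self _).trans (h2 x)⟩, ?_⟩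
  · exact integral_nonneg (fun _ => zero_le_one)
  · intro ν hν
    have := h3 ν hν
    simp only [pF]
    rw [← this]
    simp [PA_N, Measure.real]

lemma cF_facts (hΔ : 0 < Δ) (hη : 2 ≤ η) (hs : ∀ᵐ n ∂μ, n ∈ Set.Icc (-Δ) Δ) :
    Measurable (cF N η Δ μ) ∧ (∀ x, |cF N η Δ μ x| ≤ (2 * (η * Δ + Δ))^2) ∧
    ∀ ν : Measure (Fin (N-1) → ℝ), IsProbabilityMeasure ν →
      MSE_N N η Δ μ ν = (∫ x, cF N η Δ μ x ∂ν) / (4 * PA_N N η Δ μ ν) := by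
  obtain ⟨h1, h2, h3⟩ := swapF (N := N) (η := η) (B := (2 * (η * Δ + Δ))^2) hs
    (F := fun p => (max p.1 (⨆ i, p.2 i) + min p.1 (⨅ i, p.2 i))^2)
    (((meas_sup N).add (meas_inf N)).pow_const 2)
    (by positivity) (by
      intro p hp hA
      have hA' : max p.1 (⨆ i, p.2 i) - min p.1 (⨅ i, p.2 i) ≤ η * Δ := hA
      have a1 := le_max_left p.1 (⨆ i, p.2 i)
      have a2 := min_le_left p.1 (⨅ i, p.2 i)
      have a3 := hp.1
      have a4 := hp.2
      rw [abs_of_nonneg (sq_nonneg _)]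
      have : 0 ≤ η * Δ := by nlinarith
      exact sq_le_sq' (by linarith) (by linarith))
  refine ⟨h1, h2, ?_⟩
  intro ν hν
  have := h3 ν hν
  simp only [cF]
  rw [← this]
  simp only [MSE_N, PA_N, ProbabilityTheory.cond, midN, integral_smul_measure, div_pow, smul_eq_mul,
    ENNReal.toReal_inv, integral_div]
  ring
end

lemma support_line {g : ℝ → ℝ} (hg : ConcaveOn ℝ (Set.Icc (0:ℝ) 1) g) {q : ℝ} (h0 : 0 < q)
    (h1 : q < 1) : ∃ s : ℝ, ∀ t ∈ Set.Icc (0:ℝ) 1, g t ≤ g q + s * (t - q) := by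
  have hq : q ∈ interior (Set.Icc (0:ℝ) 1) := by rw [interior_Icc]; exact ⟨h0, h1⟩
  have hc := hg.neg
  refine ⟨-derivWithin (-g) (Set.Ioi q) q, fun t ht => ?_⟩
  rcases lt_trichotomy t q with h | h | h
  · have e1 := hc.slope_le_leftDeriv_of_mem_interior ht hq h
    have e2 := hc.leftDeriv_le_rightDeriv_of_mem_interior hq
    have e3 := e1.trans e2
    rw [slope_def_field, div_le_iff₀ (by linarith)] at e3
    simp only [Pi.neg_apply] at e3
    linarith
  · subst h; simp
  · have e3 := hc.rightDeriv_le_slope_of_mem_interior hq ht h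
    rw [slope_def_field, le_div_iff₀ (by linarith)] at e3
    simp only [Pi.neg_apply] at e3
    linarith

/-- Jensen without continuity. -/
lemma jensen' {X : Type*} [MeasurableSpace X] {ν : Measure X} [IsProbabilityMeasure ν]
    {g : ℝ → ℝ} (hg : ConcaveOn ℝ (Set.Icc (0:ℝ) 1) g) {p c : X → ℝ}
    (hp : Integrable p ν) (hc : Integrable c ν) (hp01 : ∀ x, p x ∈ Set.Icc (0:ℝ) 1)
    (hcg : ∀ x, c x ≤ g (p x)) (hpos : 0 < ∫ x, p x ∂ν) : ∫ x, c x ∂ν ≤ g (∫ x, p x ∂ν) := by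
  have hle : ∫ x, p x ∂ν ≤ 1 := by
    have := integral_mono hp (integrable_const (1:ℝ)) (fun x => (hp01 x).2)
    simpa using this
  rcases hle.lt_or_eq with hlt | heq
  · obtain ⟨s, hs⟩ := support_line hg hpos hlt
    set q := ∫ x, p x ∂ν with hq
    have hsub : Integrable (fun x => p x - q) ν := hp.sub (integrable_const _)
    have hsub2 : Integrable (fun x => s * (p x - q)) ν := hsub.const_mul s
    have h1 : ∫ x, c x ∂ν ≤ ∫ x, (g q + s * (p x - q)) ∂ν := by
      apply integral_mono hc
      · exact (integrable_const _).add hsub2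
      · intro x
        exact (hcg x).trans (hs _ (hp01 x))
    rw [integral_add (integrable_const _) hsub2,
      integral_const_mul, integral_sub hp (integrable_const _)] at h1
    simpa [← hq] using h1
  · have h2 : ∀ᵐ x ∂ν, p x = 1 := by
      have h3 : ∫ x, (1 - p x) ∂ν = 0 := by
        rw [integral_sub (integrable_const _) hp, heq]; simp
      have hsub : Integrable (fun x => 1 - p x) ν := (integrable_const _).sub hp
      rw [integral_eq_zero_iff_of_nonneg (fun x => by simpa using (hp01 x).2) hsub] at h3
      filter_upwards [h3] with x hx
      have : 1 - p x = 0 := hx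
      linarith
    rw [heq]
    have h4 : ∫ x, c x ∂ν ≤ ∫ _x, g 1 ∂ν := by
      apply integral_mono_ae hc (integrable_const _)
      filter_upwards [h2] with x hx
      have := hcg x
      rwa [hx] at this
    simpa using h4

section
variable {N : ℕ} {η Δ : ℝ} {μ : Measure ℝ} [IsProbabilityMeasure μ]

lemma abstract_main (hN : 2 ≤ N) (hΔ : 0 < Δ) (hη : 2 ≤ η) (hs : ∀ᵐ n ∂μ, n ∈ Set.Icc (-Δ) Δ)
    (hneg : μ.map (fun x => -x) = μ) (hna : ∀ x, μ {x} = 0) {h : ℝ → ℝ}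
    (hh : ∀ z ∈ Set.Icc ((η - 1) * Δ) ((η + 1) * Δ),
      h (∫ _n in Set.Ici (z - η * Δ), (1:ℝ) ∂μ) = ∫ n in Set.Ici (z - η * Δ), (n + z)^2 ∂μ)
    (hsurj : ∀ t ∈ Set.Icc (0:ℝ) 1, ∃ z ∈ Set.Icc ((η - 1) * Δ) ((η + 1) * Δ),
      ∫ _n in Set.Ici (z - η * Δ), (1:ℝ) ∂μ = t) (α : ℝ) (h0 : 0 < α) (h1 : α ≤ 1) :
    cN N η Δ μ α = sInf {y | ∃ g : ℝ → ℝ,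
      ConcaveOn ℝ (Set.Icc (0 : ℝ) 1) g ∧ (∀ t ∈ Set.Icc (0 : ℝ) 1, h t ≤ g t) ∧ y = g α}
        / (4 * α) := by
  haveI : Nonempty (Fin (N-1)) := ⟨⟨0, by omega⟩⟩
  obtain ⟨pm, p01, pPA⟩ := pF_facts (N := N) (η := η) hs
  obtain ⟨cm, cB, cMSE⟩ := cF_facts (N := N) hΔ hη hs
  have pint : ∀ ν : Measure (Fin (N-1) → ℝ), IsFiniteMeasure ν → Integrable (pF N η Δ μ) ν := by
    intro ν _
    refine Integrable.of_bound pm.aestronglyMeasurable 1 (Filter.Eventually.of_forall fun x => ?_)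
    rw [Real.norm_eq_abs, abs_of_nonneg (p01 x).1]; exact (p01 x).2
  have cint : ∀ ν : Measure (Fin (N-1) → ℝ), IsFiniteMeasure ν → Integrable (cF N η Δ μ) ν := by
    intro ν _
    exact Integrable.of_bound cm.aestronglyMeasurable _ (Filter.Eventually.of_forall cB)
  have ckey : ∀ x, cF N η Δ μ x ≤ h (pF N η Δ μ x) := fun x =>
    key hΔ hη hs hneg hna hh (ciInf_le_ciSup (Set.finite_range _).bddBelow
      (Set.finite_range _).bddAbove)
  have c0 : ∀ x, 0 ≤ cF N η Δ μ x := fun x => integral_nonneg fun _ => sq_nonneg _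
  -- constant strategies
  have hconst : ∀ z ∈ Set.Icc ((η - 1) * Δ) ((η + 1) * Δ),
      pF N η Δ μ (fun _ => z) = ∫ _n in Set.Ici (z - η * Δ), (1:ℝ) ∂μ ∧
      cF N η Δ μ (fun _ => z) = ∫ n in Set.Ici (z - η * Δ), (n + z)^2 ∂μ := by
    intro z hz
    have hDz : Δ ≤ z := by nlinarith [hz.1]
    have hRz : z - z ≤ η * Δ := by nlinarith
    have e1 := (key1 (μ := μ) hΔ hη hs hz.1 hRz).1
    simp only [pF, cF, ciSup_const, ciInf_const]
    refine ⟨e1, ?_⟩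
    have hset : (secN (η * Δ) z z) =ᵐ[μ] (Set.Ici (z - η * Δ)) := by
      filter_upwards [hs] with n hn
      apply propext
      change max n z - min n z ≤ η * Δ ↔ z - η * Δ ≤ n
      rw [max_eq_right (hn.2.trans hDz), min_eq_left (hn.2.trans hDz)]
      constructor <;> intro h <;> linarith
    rw [setIntegral_congr_set hset]
    congr 1
    ext n
    rw [max_add_min]
  have hnn : 0 ≤ h 0 := by
    obtain ⟨z, hz, hz2⟩ := hsurj 0 ⟨le_rfl, zero_le_one⟩
    have e := hh z hz
    rw [hz2] at e
    rw [e]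
    exact integral_nonneg fun n => sq_nonneg (n + z)
  set T := {y | ∃ g : ℝ → ℝ,
      ConcaveOn ℝ (Set.Icc (0 : ℝ) 1) g ∧ (∀ t ∈ Set.Icc (0 : ℝ) 1, h t ≤ g t) ∧ y = g α} with hT
  set S : ℝ → Set ℝ := fun q => {y | ∃ ν : Measure (Fin (N-1) → ℝ), IsProbabilityMeasure ν ∧
    ∫ x, pF N η Δ μ x ∂ν = q ∧ y = ∫ x, cF N η Δ μ x ∂ν} with hS
  have Sbdd : ∀ q, BddAbove (S q) := by
    intro q
    refine ⟨(2 * (η * Δ + Δ))^2, ?_⟩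
    rintro y ⟨ν, hν, -, rfl⟩
    have := integral_mono (cint ν inferInstance) (integrable_const ((2 * (η * Δ + Δ))^2))
      (fun x => (le_abs_self _).trans (cB x))
    simpa using this
  have Sh : ∀ q ∈ Set.Icc (0:ℝ) 1, h q ∈ S q := by
    intro q hq
    obtain ⟨z, hz, hz2⟩ := hsurj q hq
    obtain ⟨e1, e2⟩ := hconst z hz
    refine ⟨Measure.dirac (fun _ => z), inferInstance, ?_, ?_⟩
    · rw [integral_dirac, e1, hz2]
    · rw [integral_dirac, e2, ← hh z hz, hz2]
  have Cconc : ConcaveOn ℝ (Set.Icc (0:ℝ) 1) (fun q => sSup (S q)) := by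
    refine ⟨convex_Icc _ _, ?_⟩
    intro q1 hq1 q2 hq2 a b ha hb hab
    simp only [smul_eq_mul]
    apply le_of_forall_pos_le_add
    intro ε hε
    obtain ⟨y1, hy1, hy1'⟩ := exists_lt_of_lt_csSup ⟨_, Sh q1 hq1⟩
      (show sSup (S q1) - ε < sSup (S q1) by linarith)
    obtain ⟨y2, hy2, hy2'⟩ := exists_lt_of_lt_csSup ⟨_, Sh q2 hq2⟩
      (show sSup (S q2) - ε < sSup (S q2) by linarith)
    have hmem : a * y1 + b * y2 ∈ S (a * q1 + b * q2) := by
      obtain ⟨ν1, hν1, e1, rfl⟩ := hy1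
      obtain ⟨ν2, hν2, e2, rfl⟩ := hy2
      refine ⟨ENNReal.ofReal a • ν1 + ENNReal.ofReal b • ν2, ⟨?_⟩, ?_, ?_⟩
      · simp [← ENNReal.ofReal_add ha hb, hab]
      · haveI : IsFiniteMeasure (ENNReal.ofReal a • ν1) := ν1.smul_finite ENNReal.ofReal_ne_top
        haveI : IsFiniteMeasure (ENNReal.ofReal b • ν2) := ν2.smul_finite ENNReal.ofReal_ne_top
        rw [integral_add_measure (pint _ inferInstance) (pint _ inferInstance),
          integral_smul_measure, integral_smul_measure, e1, e2,
          ENNReal.toReal_ofReal ha, ENNReal.toReal_ofReal hb]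
        rfl
      · haveI : IsFiniteMeasure (ENNReal.ofReal a • ν1) := ν1.smul_finite ENNReal.ofReal_ne_top
        haveI : IsFiniteMeasure (ENNReal.ofReal b • ν2) := ν2.smul_finite ENNReal.ofReal_ne_top
        rw [integral_add_measure (cint _ inferInstance) (cint _ inferInstance),
          integral_smul_measure, integral_smul_measure,
          ENNReal.toReal_ofReal ha, ENNReal.toReal_ofReal hb]
        rfl
    have := le_csSup (Sbdd _) hmem
    have f1 := mul_le_mul_of_nonneg_left hy1'.le ha
    have f2 := mul_le_mul_of_nonneg_left hy2'.le hb
    have f3 : a * ε + b * ε = ε := by rw [← add_mul, hab, one_mul]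
    linarith
  have hαm : α ∈ Set.Icc (0:ℝ) 1 := ⟨h0.le, h1⟩
  have hCT : sSup (S α) ∈ T :=
    ⟨fun q => sSup (S q), Cconc, fun t ht => le_csSup (Sbdd t) (Sh t ht), rfl⟩
  have Tbdd : BddBelow T := by
    refine ⟨h α, ?_⟩
    rintro y ⟨g, -, hg, rfl⟩
    exact hg α hαm
  -- upper bound
  have upper : ∀ ν : Measure (Fin (N-1) → ℝ), IsProbabilityMeasure ν → α ≤ PA_N N η Δ μ ν →
      MSE_N N η Δ μ ν ≤ sInf T / (4 * α) := by
    intro ν hν hP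
    rw [le_div_iff₀ (by linarith)]
    apply le_csInf ⟨_, hCT⟩
    rintro y ⟨g, hgc, hg, rfl⟩
    rw [cMSE ν hν]
    set P := PA_N N η Δ μ ν with hPdef
    have hP0 : 0 < P := h0.trans_le hP
    have j := jensen' (ν := ν) hgc (pint ν inferInstance) (cint ν inferInstance) p01
      (fun x => (ckey x).trans (hg _ (p01 x))) (by rw [← pPA ν hν]; exact hP0)
    rw [← pPA ν hν] at j
    have hP1 : P ≤ 1 := by
      rw [hPdef, pPA ν hν]
      have := integral_mono (pint ν inferInstance) (integrable_const (1:ℝ)) (fun x => (p01 x).2)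
      simpa using this
    have hb : 0 ≤ 1 - α / P := by rw [sub_nonneg, div_le_one hP0]; exact hP
    have ha : 0 ≤ α / P := by positivity
    have hcc := hgc.2 (show P ∈ Set.Icc (0:ℝ) 1 from ⟨hP0.le, hP1⟩)
      (show (0:ℝ) ∈ Set.Icc (0:ℝ) 1 from ⟨le_rfl, zero_le_one⟩) ha hb (by ring)
    simp only [smul_eq_mul, mul_zero, add_zero] at hcc
    rw [div_mul_cancel₀ _ hP0.ne'] at hcc
    have hg0 : 0 ≤ g 0 := hnn.trans (hg 0 ⟨le_rfl, zero_le_one⟩)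
    have hb : 0 ≤ 1 - α / P := by rw [sub_nonneg, div_le_one hP0]; exact hP
    have h7 : α / P * (∫ x, cF N η Δ μ x ∂ν) ≤ α / P * g P :=
      mul_le_mul_of_nonneg_left j (by positivity)
    have h8 : (∫ x, cF N η Δ μ x ∂ν) / (4 * P) * (4 * α) = α / P * (∫ x, cF N η Δ μ x ∂ν) := by
      field_simp
    rw [h8]
    nlinarith [mul_nonneg hb hg0]
  unfold cN
  apply le_antisymm
  · apply csSup_le
    · obtain ⟨ν, hν, e, -⟩ := Sh α hαm
      exact ⟨_, ν, hν, by rw [pPA ν hν, e], rfl⟩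
    · rintro r ⟨ν, hν, hP, rfl⟩
      exact upper ν hν hP
  · rw [div_le_iff₀ (by linarith)]
    refine (csInf_le Tbdd hCT).trans ?_
    apply csSup_le ⟨_, Sh α hαm⟩
    rintro y ⟨ν, hν, e, rfl⟩
    rw [← div_le_iff₀ (by linarith)]
    apply le_csSup
    · refine ⟨sInf T / (4 * α), ?_⟩
      rintro r ⟨ν, hν, hP, rfl⟩
      exact upper ν hν hP
    · exact ⟨ν, hν, by rw [pPA ν hν, e], by rw [cMSE ν hν, pPA ν hν, e]⟩
end

theorem stmt9 {N : ℕ} (hN : 2 ≤ N) {η Δ : ℝ} (hΔ : 0 < Δ) (hη : 2 ≤ η)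
    (f : ℝ → ℝ) (hf0 : ∀ x, 0 ≤ f x) (hfm : Measurable f) (hfi : Integrable f)
    (hfs : ∀ x, x ∉ Set.Icc (-Δ) Δ → f x = 0)
    (hsymm : ∀ x, f (-x) = f x)
    (hf1 : (∫ x in (-Δ)..Δ, f x) = 1)
    (hfpos : ∀ a b : ℝ, -Δ ≤ a → a < b → b ≤ Δ → 0 < ∫ x in a..b, f x)
    (μ : Measure ℝ) (hμ : μ = volume.withDensity fun x => ENNReal.ofReal (f x))
    (kη vη : ℝ → ℝ)
    (hk : ∀ z, kη z = ∫ x in (z - η * Δ)..Δ, f x)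
    (hv : ∀ z, vη z = ∫ x in (z - η * Δ)..Δ, (x + z) ^ 2 * f x)
    (h : ℝ → ℝ)
    (hh : ∀ q ∈ Set.Icc (0 : ℝ) 1, ∀ z ∈ Set.Icc ((η - 1) * Δ) ((η + 1) * Δ),
      kη z = q → h q = vη z)
    (hstar : ℝ → ℝ)
    (hstarDef : ∀ q : ℝ, hstar q = sInf {y | ∃ g : ℝ → ℝ,
      ConcaveOn ℝ (Set.Icc (0 : ℝ) 1) g ∧ (∀ t ∈ Set.Icc (0 : ℝ) 1, h t ≤ g t) ∧ y = g q}) :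
    ∀ α : ℝ, 0 < α → α ≤ 1 → cN N η Δ μ α = hstar α / (4 * α) := by
  have hle : -Δ ≤ Δ := by linarith
  have hint : ∫ x, f x = 1 := by
    rw [← hf1, intervalIntegral.integral_of_le hle, ← integral_Icc_eq_integral_Ioc,
      setIntegral_eq_integral_of_forall_compl_eq_zero hfs]
  have hfe : Measurable fun x => ENNReal.ofReal (f x) := hfm.ennreal_ofReal
  haveI : IsProbabilityMeasure μ := by
    constructor
    rw [hμ, withDensity_apply _ MeasurableSet.univ, Measure.restrict_univ,
      ← ofReal_integral_eq_lintegral_ofReal hfi (Filter.Eventually.of_forall hf0), hint]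
    simp
  have hs : ∀ᵐ n ∂μ, n ∈ Set.Icc (-Δ) Δ := by
    rw [ae_iff, hμ]
    change (volume.withDensity fun x => ENNReal.ofReal (f x)) (Set.Icc (-Δ) Δ)ᶜ = 0
    rw [withDensity_apply _ measurableSet_Icc.compl]
    apply setLIntegral_eq_zero measurableSet_Icc.compl
    intro x hx
    simp [hfs x hx]
  have hneg : μ.map (fun x => -x) = μ := by
    ext s hs
    rw [Measure.map_apply measurable_neg hs, hμ, withDensity_apply _ hs,
      withDensity_apply _ (measurable_neg hs), ← lintegral_indicator hs,
      ← lintegral_indicator (measurable_neg hs), ← lintegral_neg_eq_self]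
    congr 1
    ext x
    by_cases hx : x ∈ s <;> simp [Set.indicator, hx, hsymm]
  have hna : ∀ x, μ {x} = 0 := by
    intro x
    have : μ ≪ volume := by rw [hμ]; exact withDensity_absolutelyContinuous _ _
    exact this (by simp)
  have hconv : ∀ (g : ℝ → ℝ) (w : ℝ), w ≤ Δ →
      ∫ n in Set.Ici w, g n ∂μ = ∫ x in w..Δ, g x * f x := by
    intro g w hw
    rw [hμ, setIntegral_withDensity_eq_setIntegral_toReal_smul hfe
      (Filter.Eventually.of_forall fun x => ENNReal.ofReal_lt_top) _ measurableSet_Ici,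
      integral_Ici_eq_integral_Ioi, intervalIntegral.integral_of_le hw]
    symm
    have e : ∀ x, (ENNReal.ofReal (f x)).toReal • g x = g x * f x := by
      intro x; rw [ENNReal.toReal_ofReal (hf0 x), smul_eq_mul, mul_comm]
    simp only [e]
    symm
    apply setIntegral_eq_of_subset_of_forall_diff_eq_zero measurableSet_Ioi Set.Ioc_subset_Ioi_self
    intro x hx
    rw [hfs x, mul_zero]
    intro hx2
    exact hx.2 ⟨hx.1, hx2.2⟩
  have hK : ∀ z ∈ Set.Icc ((η - 1) * Δ) ((η + 1) * Δ),
      ∫ _n in Set.Ici (z - η * Δ), (1:ℝ) ∂μ = kη z := by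
    intro z hz
    rw [hconv (fun _ => 1) _ (by linarith [hz.2]), hk z]
    simp
  have hV : ∀ z ∈ Set.Icc ((η - 1) * Δ) ((η + 1) * Δ),
      ∫ n in Set.Ici (z - η * Δ), (n + z)^2 ∂μ = vη z := by
    intro z hz
    rw [hconv (fun n => (n + z)^2) _ (by linarith [hz.2]), hv z]
  intro α h0 h1
  rw [hstarDef α]
  refine abstract_main hN hΔ hη hs hneg hna ?_ ?_ α h0 h1
  · intro z hz
    rw [hV z hz]
    refine hh _ ⟨integral_nonneg fun _ => zero_le_one, ?_⟩ z hz (hK z hz).symm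
    simp only [integral_const, smul_eq_mul, mul_one]
    simpa using prob_le_one
  · have hkc : Continuous kη := by
      have e : kη = fun z => -∫ x in Δ..(z - η * Δ), f x := by
        ext z; rw [hk z, intervalIntegral.integral_symm]
      rw [e]
      exact ((intervalIntegral.continuous_primitive (fun a b => hfi.intervalIntegrable) Δ).comp
        (by fun_prop : Continuous fun z : ℝ => z - η * Δ)).neg
    intro t ht
    have hz01 : (η - 1) * Δ ≤ (η + 1) * Δ := by nlinarith
    have e1 : kη ((η - 1) * Δ) = 1 := by
      rw [hk, show (η - 1) * Δ - η * Δ = -Δ by ring, hf1]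
    have e2 : kη ((η + 1) * Δ) = 0 := by
      rw [hk, show (η + 1) * Δ - η * Δ = Δ by ring]; simp
    have := intermediate_value_Icc' hz01 hkc.continuousOn
    rw [e1, e2] at this
    obtain ⟨z, hz, hz2⟩ := this ht
    exact ⟨z, hz, by rw [hK z hz, hz2]⟩
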